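/- Let d ≥ 1 be an integer and let 0 < k < d. There exists a constant C > 0, depending only on d and k, such that for every t > 0 and all x, y ∈ ℝ^d with x ≠ y, ∫_{ℝ^d} p_t(z) |z − x|^{−k} |z − y|^{−k} dz ≤ C t^{−k/2} |x − y|^{−k}. (Probabilistically, the left-hand side is E[|W_t − x|^{−k} |W_t − y|^{−k}] for a d-dimensional Brownian motion W started at 0.) -/

import Mathlib

open Real MeasureTheory

/-- The Gaussian heat kernel `p_t(x) = (2πt)^{-d/2} exp(-|x|²/(2t))` on `ℝ^d`. -/
noncomputable def heatKernel (d : ℕ) (t : ℝ) (x : EuclideanSpace ℝ (Fin d)) : ℝ :=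
  (2 * Real.pi * t) ^ (-(d : ℝ) / 2) * Real.exp (-‖x‖ ^ 2 / (2 * t))

lemma heatKernel_nonneg (d : ℕ) {t : ℝ} (ht : 0 < t) (x : EuclideanSpace ℝ (Fin d)) :
    0 ≤ heatKernel d t x := by
  unfold heatKernel
  positivity

lemma heatKernel_le (d : ℕ) {t : ℝ} (ht : 0 < t) (x : EuclideanSpace ℝ (Fin d)) :
    heatKernel d t x ≤ (2 * Real.pi * t) ^ (-(d : ℝ) / 2) := by
  unfold heatKernel
  refine mul_le_of_le_one_right (by positivity) (Real.exp_le_one_iff.2 ?_)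
  exact div_nonpos_of_nonpos_of_nonneg (by simp) (by positivity)

lemma integral_heatKernel (d : ℕ) {t : ℝ} (ht : 0 < t) :
    ∫ z, heatKernel d t z = 1 := by
  have h := GaussianFourier.integral_rexp_neg_mul_sq_norm (V := EuclideanSpace ℝ (Fin d))
    (b := 1 / (2 * t)) (by positivity)
  have h2 : ∀ z : EuclideanSpace ℝ (Fin d), heatKernel d t z =
      (2 * Real.pi * t) ^ (-(d : ℝ) / 2) * Real.exp (-(1 / (2 * t)) * ‖z‖ ^ 2) := by
    intro z
    unfold heatKernel
    congr 2
    ring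
  simp_rw [h2]
  rw [integral_const_mul, h, finrank_euclideanSpace_fin,
    show π / (1 / (2 * t)) = 2 * π * t by field_simp, ← Real.rpow_add (by positivity)]
  simp [neg_div]

lemma integrable_heatKernel (d : ℕ) {t : ℝ} (ht : 0 < t) :
    Integrable (heatKernel d t) :=
  .of_integral_ne_zero (by rw [integral_heatKernel d ht]; exact one_ne_zero)

/-- The Riesz kernel `|w|^{-k}` with `k < d` is integrable on the unit ball of `ℝ^d`. -/
lemma integrable_indicator_norm_rpow_neg {d : ℕ} (hd : 1 ≤ d) {k : ℝ} (hkd : k < d) :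
    Integrable (fun w : EuclideanSpace ℝ (Fin d) ↦
      (Set.Iio 1).indicator (fun r : ℝ ↦ r ^ (-k)) ‖w‖) := by
  have : Nonempty (Fin d) := ⟨⟨0, hd⟩⟩
  rw [integrable_fun_norm_addHaar volume (f := (Set.Iio 1).indicator (fun r : ℝ ↦ r ^ (-k))),
    finrank_euclideanSpace_fin]
  have h : IntegrableOn (fun r : ℝ ↦ r ^ ((d : ℝ) - 1 - k)) (Set.Ioo 0 1) :=
    (intervalIntegral.integrableOn_Ioo_rpow_iff one_pos).2 (by linarith)
  have h2 := (integrable_indicator_iff measurableSet_Ioo).2 h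
  refine h2.integrableOn.congr_fun (s := Set.Ioi 0) ?_ measurableSet_Ioi
  intro r hr
  have hr : 0 < r := hr
  by_cases h1 : r < 1
  · simp only [Set.indicator, Set.mem_Ioo, hr, h1, and_self, if_true, Set.mem_Iio, smul_eq_mul]
    rw [← Real.rpow_natCast, ← Real.rpow_add hr, Nat.cast_sub hd]
    congr 1
    push_cast
    ring
  · simp [Set.indicator, h1]

lemma rpow_neg_le_add_indicator {k : ℝ} (hk0 : 0 < k) {s r : ℝ} (hs : 0 < s) (hr : 0 ≤ r) :
    r ^ (-k) ≤ s ^ (-k) + s ^ (-k) * (Set.Iio 1).indicator (fun r : ℝ ↦ r ^ (-k)) (s⁻¹ * r) := by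
  by_cases h : s⁻¹ * r < 1
  · rw [Set.indicator_of_mem (Set.mem_Iio.2 h), ← Real.mul_rpow hs.le (by positivity),
      mul_inv_cancel_left₀ hs.ne']
    linarith [Real.rpow_nonneg hs.le (-k)]
  · rw [Set.indicator_of_notMem (by simpa using h), mul_zero, add_zero]
    have h' : s ≤ r := by
      rw [inv_mul_lt_iff₀ hs] at h
      linarith
    exact Real.rpow_le_rpow_of_nonpos hs h' (by linarith)

/-- Gaussian potentials of the Riesz kernel are bounded by `C t^{-k/2}`, uniformly in the centre. -/
lemma exists_riesz_heatKernel_bound {d : ℕ} (hd : 1 ≤ d) {k : ℝ} (hk0 : 0 < k) (hkd : k < d) :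
    ∃ C : ℝ, 0 < C ∧ ∀ t : ℝ, 0 < t → ∀ x : EuclideanSpace ℝ (Fin d),
      Integrable (fun z ↦ heatKernel d t z * ‖z - x‖ ^ (-k)) ∧
      ∫ z, heatKernel d t z * ‖z - x‖ ^ (-k) ≤ C * t ^ (-k / 2) := by
  set φ : EuclideanSpace ℝ (Fin d) → ℝ :=
    fun w ↦ (Set.Iio 1).indicator (fun r : ℝ ↦ r ^ (-k)) ‖w‖ with hφ
  have hφi : Integrable φ := integrable_indicator_norm_rpow_neg hd hkd
  have hφ0 : ∀ w, 0 ≤ φ w := fun w ↦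
    Set.indicator_apply_nonneg fun _ ↦ Real.rpow_nonneg (norm_nonneg w) _
  have hI : 0 ≤ ∫ w, φ w := integral_nonneg hφ0
  refine ⟨1 + (2 * π) ^ (-(d : ℝ) / 2) * ∫ w, φ w, by positivity, fun t ht x ↦ ?_⟩
  have hs : 0 < √t := Real.sqrt_pos.2 ht
  have hsk : √t ^ (-k) = t ^ (-k / 2) := by
    rw [Real.sqrt_eq_rpow, ← Real.rpow_mul ht.le]
    congr 1
    ring
  set A := (2 * π * t) ^ (-(d : ℝ) / 2) with hA
  have hA0 : 0 ≤ A := by positivity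
  have hψi : Integrable fun z ↦ φ ((√t)⁻¹ • (z - x)) :=
    (hφi.comp_smul (inv_ne_zero hs.ne')).comp_sub_right x
  have hψ : ∫ z, φ ((√t)⁻¹ • (z - x)) = √t ^ d * ∫ w, φ w := by
    rw [integral_sub_right_eq_self (fun z ↦ φ ((√t)⁻¹ • z)) x,
      Measure.integral_comp_inv_smul_of_nonneg volume φ hs.le, finrank_euclideanSpace_fin,
      smul_eq_mul]
  have hbi := ((integrable_heatKernel d ht).mul_const (√t ^ (-k))).add
    (hψi.const_mul (A * √t ^ (-k)))
  have hle : ∀ z, heatKernel d t z * ‖z - x‖ ^ (-k) ≤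
      heatKernel d t z * √t ^ (-k) + A * √t ^ (-k) * φ ((√t)⁻¹ • (z - x)) := by
    intro z
    have h1 := rpow_neg_le_add_indicator hk0 hs (norm_nonneg (z - x))
    have h2 : φ ((√t)⁻¹ • (z - x)) =
        (Set.Iio 1).indicator (fun r : ℝ ↦ r ^ (-k)) ((√t)⁻¹ * ‖z - x‖) := by
      simp [hφ, norm_smul, abs_of_pos hs]
    rw [← h2] at h1
    calc _ ≤ heatKernel d t z * (√t ^ (-k) + √t ^ (-k) * φ ((√t)⁻¹ • (z - x))) :=
          mul_le_mul_of_nonneg_left h1 (heatKernel_nonneg d ht z)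
      _ = heatKernel d t z * √t ^ (-k) +
          heatKernel d t z * (√t ^ (-k) * φ ((√t)⁻¹ • (z - x))) := mul_add _ _ _
      _ ≤ heatKernel d t z * √t ^ (-k) + A * (√t ^ (-k) * φ ((√t)⁻¹ • (z - x))) := by
          gcongr
          · exact mul_nonneg (by positivity) (hφ0 _)
          · exact heatKernel_le d ht z
      _ = _ := by rw [mul_assoc]
  have h0 : ∀ z, 0 ≤ heatKernel d t z * ‖z - x‖ ^ (-k) := fun z ↦
    mul_nonneg (heatKernel_nonneg d ht z) (by positivity)
  have hint : Integrable (fun z ↦ heatKernel d t z * ‖z - x‖ ^ (-k)) := by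
    refine hbi.mono' ?_ (.of_forall fun z ↦ ?_)
    · refine (integrable_heatKernel d ht).aestronglyMeasurable.mul ?_
      exact (by fun_prop : Measurable fun z : EuclideanSpace ℝ (Fin d) ↦
        ‖z - x‖ ^ (-k)).aestronglyMeasurable
    · rw [Real.norm_of_nonneg (h0 z)]
      exact hle z
  refine ⟨hint, (integral_mono hint hbi hle).trans_eq ?_⟩
  simp only [Pi.add_apply]
  rw [integral_add ((integrable_heatKernel d ht).mul_const _) (hψi.const_mul _),
    integral_mul_const, integral_const_mul, integral_heatKernel d ht, hψ, hsk]
  have hAd : A * √t ^ d = (2 * π) ^ (-(d : ℝ) / 2) := by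
    rw [hA, Real.mul_rpow (by positivity) ht.le, Real.sqrt_eq_rpow, ← Real.rpow_mul_natCast ht.le,
      mul_assoc, ← Real.rpow_add ht]
    simp [div_eq_inv_mul]
  rw [← hAd]
  ring

lemma rpow_neg_mul_rpow_neg_le {k : ℝ} (hk0 : 0 < k) {a b c : ℝ} (ha : 0 ≤ a) (hb : 0 ≤ b)
    (hc : 0 < c) (h : c ≤ a + b) :
    a ^ (-k) * b ^ (-k) ≤ (2 : ℝ) ^ k * c ^ (-k) * (a ^ (-k) + b ^ (-k)) := by
  wlog hab : a ≤ b generalizing a b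
  · rw [mul_comm (a ^ (-k)), add_comm (a ^ (-k))]
    exact this hb ha (by linarith) (by linarith)
  have h1 : b ^ (-k) ≤ (2 : ℝ) ^ k * c ^ (-k) := by
    calc b ^ (-k) ≤ (c / 2) ^ (-k) :=
          Real.rpow_le_rpow_of_nonpos (by positivity) (by linarith) (by linarith)
      _ = (2 : ℝ) ^ k * c ^ (-k) := by
          rw [Real.div_rpow hc.le zero_le_two, Real.rpow_neg zero_le_two, div_inv_eq_mul, mul_comm]
  calc a ^ (-k) * b ^ (-k) ≤ a ^ (-k) * ((2 : ℝ) ^ k * c ^ (-k)) := by gcongr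
    _ = (2 : ℝ) ^ k * c ^ (-k) * a ^ (-k) := mul_comm _ _
    _ ≤ _ := by
        gcongr
        exact le_add_of_nonneg_right (by positivity)

theorem double_riesz_heatKernel_bound (d : ℕ) (hd : 1 ≤ d) (k : ℝ)
    (hk0 : 0 < k) (hkd : k < d) :
    ∃ C : ℝ, 0 < C ∧ ∀ t : ℝ, 0 < t → ∀ x y : EuclideanSpace ℝ (Fin d), x ≠ y →
      (∫ z, heatKernel d t z * ‖z - x‖ ^ (-k) * ‖z - y‖ ^ (-k)) ≤
        C * t ^ (-k / 2) * ‖x - y‖ ^ (-k) := by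
  obtain ⟨C, hC, hbound⟩ := exists_riesz_heatKernel_bound hd hk0 hkd
  refine ⟨2 ^ k * (C + C), by positivity, fun t ht x y hxy ↦ ?_⟩
  obtain ⟨hxi, hx⟩ := hbound t ht x
  obtain ⟨hyi, hy⟩ := hbound t ht y
  have hc : 0 < ‖x - y‖ := norm_pos_iff.2 (sub_ne_zero.2 hxy)
  calc (∫ z, heatKernel d t z * ‖z - x‖ ^ (-k) * ‖z - y‖ ^ (-k))
      ≤ ∫ z, 2 ^ k * ‖x - y‖ ^ (-k) *
          (heatKernel d t z * ‖z - x‖ ^ (-k) + heatKernel d t z * ‖z - y‖ ^ (-k)) := by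
        refine integral_mono_of_nonneg (.of_forall fun z ↦ ?_) ((hxi.add hyi).const_mul _)
          (.of_forall fun z ↦ ?_)
        · exact mul_nonneg (mul_nonneg (heatKernel_nonneg d ht z) (by positivity)) (by positivity)
        · have htri : ‖x - y‖ ≤ ‖z - x‖ + ‖z - y‖ := by
            rw [norm_sub_rev z x]
            exact norm_sub_le_norm_sub_add_norm_sub x z y
          have := mul_le_mul_of_nonneg_left (rpow_neg_mul_rpow_neg_le hk0 (norm_nonneg (z - x))
            (norm_nonneg (z - y)) hc htri) (heatKernel_nonneg d ht z)
          calc _ = heatKernel d t z * (‖z - x‖ ^ (-k) * ‖z - y‖ ^ (-k)) := mul_assoc _ _ _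
            _ ≤ _ := this
            _ = _ := by ring
    _ = 2 ^ k * ‖x - y‖ ^ (-k) * ((∫ z, heatKernel d t z * ‖z - x‖ ^ (-k)) +
          ∫ z, heatKernel d t z * ‖z - y‖ ^ (-k)) := by
        rw [integral_const_mul, integral_add hxi hyi]
    _ ≤ 2 ^ k * ‖x - y‖ ^ (-k) * (C * t ^ (-k / 2) + C * t ^ (-k / 2)) := by gcongr
    _ = _ := by ring
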